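/- arXiv:1009.1922 — 2 statements merged into one kernel-verified Lean document; each statement's English description precedes it below -/
import Mathlib

section
/- Let u₀,…,u_m be continuous real functions on an interval Δ forming an AT-system for the multi-index n = (n₀,…,n_m) (i.e., every nontrivial form Σ p_k u_k with deg p_k ≤ n_k−1 has at most |n|−1 zeros on Δ). Let s be a positive measure on Δ with infinitely many support points, and suppose a continuous function A on Δ satisfies ∫ L(x)·A(x) ds(x) = 0 for every form L = Σ_{k=0}^m p_k u_k with deg p_k ≤ n_k − 1. If A has only finitely many sign changes on the interior of Δ, then A has at least |n| sign changes there, where |n| = n₀+⋯+n_m. -/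
open MeasureTheory Filter Set Polynomial

/-- The support of a measure. -/
def msupport (s : Measure ℝ) : Set ℝ := {x : ℝ | ∀ U ∈ nhds x, s U ≠ 0}

/-- Every nontrivial linear combination of the `N` functions `φ i` has fewer than `N` zeros
on `Δ`. -/
def IsTchebychevOn {N : ℕ} (φ : Fin N → ℝ → ℝ) (Δ : Set ℝ) : Prop :=
  ∀ c : Fin N → ℝ, c ≠ 0 → ∀ S : Finset ℝ,
    (∀ x ∈ S, x ∈ Δ ∧ ∑ i, c i * φ i x = 0) → S.card < N

/-- The collocation matrix of the functions `φ` at the points `z`. -/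
def collocation {N : ℕ} (φ : Fin N → ℝ → ℝ) (z : Fin N → ℝ) : Matrix (Fin N) (Fin N) ℝ :=
  Matrix.of fun i j => φ j (z i)

namespace IsTchebychevOn

theorem det_collocation_ne_zero {N : ℕ} {φ : Fin N → ℝ → ℝ} {Δ : Set ℝ}
    (h : IsTchebychevOn φ Δ) {z : Fin N → ℝ} (hz : Function.Injective z) (hzΔ : ∀ i, z i ∈ Δ) :
    (collocation φ z).det ≠ 0 := by
  intro h0
  obtain ⟨v, hv, hv0⟩ := Matrix.exists_mulVec_eq_zero_iff.2 h0
  have hcard := h v hv (Finset.univ.image z) (by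
    intro x hx
    obtain ⟨i, -, rfl⟩ := Finset.mem_image.1 hx
    refine ⟨hzΔ i, ?_⟩
    have := congrFun hv0 i
    simpa [Matrix.mulVec, dotProduct, collocation, mul_comm] using this)
  rw [Finset.card_image_of_injective _ hz] at hcard
  simp at hcard

theorem det_collocation_mul_pos {N : ℕ} {φ : Fin N → ℝ → ℝ} {Δ : Set ℝ}
    (h : IsTchebychevOn φ Δ) (hΔ : Δ.OrdConnected) (hφ : ∀ i, ContinuousOn (φ i) Δ)
    {z w : Fin N → ℝ} (hz : StrictMono z) (hzΔ : ∀ i, z i ∈ Δ)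
    (hw : StrictMono w) (hwΔ : ∀ i, w i ∈ Δ) :
    0 < (collocation φ z).det * (collocation φ w).det := by
  set T : Set (Fin N → ℝ) := {x | StrictMono x ∧ ∀ i, x i ∈ Δ} with hT
  have hconv : Convex ℝ T := by
    intro x hx y hy a b ha hb hab
    refine ⟨fun i j hij => ?_, fun i => ?_⟩
    · have h1 := hx.1 hij
      have h2 := hy.1 hij
      simp only [Pi.add_apply, Pi.smul_apply, smul_eq_mul]
      rcases ha.eq_or_lt with rfl | ha'
      · simp only [zero_add] at hab
        subst hab
        linarith
      · nlinarith [mul_le_mul_of_nonneg_left h2.le hb, mul_lt_mul_of_pos_left h1 ha']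
    · exact hΔ.convex (hx.2 i) (hy.2 i) ha hb hab
  have hcont : ContinuousOn (fun x => (collocation φ x).det) T := by
    rw [continuousOn_iff_continuous_domRestrict]
    refine Continuous.matrix_det (continuous_matrix fun i j => ?_)
    change Continuous fun x : T => φ j (x.1 i)
    exact (hφ j).comp_continuous ((continuous_apply i).comp continuous_subtype_val) fun x => x.2.2 i
  have hne : ∀ x ∈ T, (collocation φ x).det ≠ 0 := fun x hx =>
    h.det_collocation_ne_zero hx.1.injective hx.2
  have key : ∀ x ∈ T, ∀ y ∈ T, (collocation φ x).det < 0 → 0 < (collocation φ y).det → False := by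
    intro x hx y hy hx0 hy0
    obtain ⟨v, hv, hv0⟩ := hconv.isPreconnected.intermediate_value hx hy hcont
      ⟨hx0.le, hy0.le⟩
    exact hne v hv hv0
  have hzT : z ∈ T := ⟨hz, hzΔ⟩
  have hwT : w ∈ T := ⟨hw, hwΔ⟩
  rcases (hne z hzT).lt_or_gt with h1 | h1 <;> rcases (hne w hwT).lt_or_gt with h2 | h2
  · exact mul_pos_of_neg_of_neg h1 h2
  · exact (key z hzT w hwT h1 h2).elim
  · exact (key w hwT z hzT h2 h1).elim
  · exact mul_pos h1 h2

/-- A form vanishing at prescribed points and changing sign exactly there. -/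
theorem exists_sign_changes {k : ℕ} {φ : Fin (k + 1) → ℝ → ℝ} {Δ : Set ℝ}
    (h : IsTchebychevOn φ Δ) (hΔ : Δ.OrdConnected) (hφ : ∀ i, ContinuousOn (φ i) Δ)
    (hinf : Δ.Infinite) {Y : Finset ℝ} (hY : Y.card = k) (hYΔ : ∀ y ∈ Y, y ∈ Δ) :
    ∃ c : Fin (k + 1) → ℝ, c ≠ 0 ∧ (∀ y ∈ Y, ∑ i, c i * φ i y = 0) ∧
      ∀ x ∈ Δ, x ∉ Y → 0 < (-1) ^ (Y.filter (· < x)).card * ∑ i, c i * φ i x := by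
  obtain ⟨Z, hZΔ, hZ⟩ := hinf.exists_subset_card_eq (k + 1)
  set w := Z.orderEmbOfFin hZ
  set δ := (collocation φ w).det
  set y := Y.orderEmbOfFin hY
  set c₀ : Fin (k + 1) → ℝ := fun j =>
    (-1) ^ (j : ℕ) * (Matrix.of fun (i : Fin k) (l : Fin k) => φ (j.succAbove l) (y i)).det with hc₀
  have hzero : ∀ x ∈ Y, ∑ i, c₀ i * φ i x = 0 := by
    intro x hx
    have hx' : x ∈ Set.range y := by simpa [y] using hx
    obtain ⟨i, rfl⟩ := hx'
    have h0 : (collocation φ (Fin.cons (y i) y)).det = 0 :=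
      Matrix.det_zero_of_row_eq (i := 0) (j := i.succ) (Fin.succ_ne_zero i).symm (by
        ext j
        simp [collocation])
    rw [Matrix.det_succ_row_zero] at h0
    rw [← h0]
    refine Finset.sum_congr rfl fun j _ => ?_
    have : (collocation φ (Fin.cons (y i) y)).submatrix Fin.succ j.succAbove =
        Matrix.of fun (i : Fin k) (l : Fin k) => φ (j.succAbove l) (y i) := by
      ext a b
      simp [collocation]
    rw [this]
    simp [hc₀, collocation]
    ring
  have hpos : ∀ x ∈ Δ, x ∉ Y →
      0 < (-1) ^ (Y.filter (· < x)).card * ∑ i, δ * c₀ i * φ i x := by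
    intro x hx hxY
    have hcard : (insert x Y).card = k + 1 := by rw [Finset.card_insert_of_notMem hxY, hY]
    set z := (insert x Y).orderEmbOfFin hcard with hz
    have hzΔ : ∀ i, z i ∈ Δ := by
      intro i
      have := Finset.orderEmbOfFin_mem (insert x Y) hcard i
      rcases Finset.mem_insert.1 this with h' | h'
      · rw [hz, h']; exact hx
      · exact hYΔ _ h'
    have hx' : x ∈ Set.range z := by simp [z]
    obtain ⟨p, hp⟩ := hx'
    have hyz : (fun i => z (p.succAbove i)) = y := by
      refine Finset.orderEmbOfFin_unique hY (fun i => ?_)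
        (z.strictMono.comp (Fin.strictMono_succAbove p))
      have := Finset.orderEmbOfFin_mem (insert x Y) hcard (p.succAbove i)
      rcases Finset.mem_insert.1 this with h' | h'
      · exact (Fin.succAbove_ne p i (z.injective (h'.trans hp.symm))).elim
      · exact h'
    have hfilter : Y.filter (· < x) = (Finset.Iio p).image z := by
      ext a
      simp only [Finset.mem_filter, Finset.mem_image, Finset.mem_Iio]
      constructor
      · rintro ⟨ha, hax⟩
        have ha' : a ∈ Set.range z := by simp [z, ha]
        obtain ⟨q, rfl⟩ := ha'
        rw [← hp] at hax
        exact ⟨q, z.strictMono.lt_iff_lt.1 hax, rfl⟩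
      · rintro ⟨q, hq, rfl⟩
        have hlt : z q < x := hp ▸ z.strictMono hq
        have := Finset.orderEmbOfFin_mem (insert x Y) hcard q
        exact ⟨(Finset.mem_insert.1 this).resolve_left hlt.ne, hlt⟩
    have hcardp : (Y.filter (· < x)).card = (p : ℕ) := by
      rw [hfilter, Finset.card_image_of_injective _ z.injective, Fin.card_Iio]
    have hdet : (collocation φ z).det = (-1) ^ (p : ℕ) * ∑ i, c₀ i * φ i x := by
      rw [Matrix.det_succ_row _ p, Finset.mul_sum]
      refine Finset.sum_congr rfl fun j _ => ?_
      have : (collocation φ z).submatrix p.succAbove j.succAbove =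
          Matrix.of fun (i : Fin k) (l : Fin k) => φ (j.succAbove l) (y i) := by
        ext a b
        simp [collocation, ← hyz]
      rw [this]
      simp only [collocation, Matrix.of_apply, hp, hc₀, pow_add]
      ring
    have := h.det_collocation_mul_pos hΔ hφ w.strictMono
      (fun i => hZΔ (Finset.orderEmbOfFin_mem Z hZ i)) z.strictMono hzΔ
    rw [hdet] at this
    rw [hcardp]
    calc 0 < _ := this
      _ = _ := by
        simp only [mul_assoc, ← Finset.mul_sum]
        ring
  refine ⟨fun i => δ * c₀ i, ?_, fun x hx => ?_, hpos⟩
  · intro hc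
    obtain ⟨x, hx, hxY⟩ := hinf.exists_notMem_finset Y
    have := hpos x hx hxY
    have h0 : ∀ i, δ * c₀ i = 0 := fun i => congrFun hc i
    simp [h0] at this
  · simp only [mul_assoc, ← Finset.mul_sum, hzero x hx, mul_zero]

end IsTchebychevOn

/-- A function without zeros on a finite set `X` has an alternating sequence of points of `X`
whose number of sign changes equals the number of points in a set separating its signs. -/
theorem exists_alternating_separating (A : ℝ → ℝ) (X : Finset ℝ) (hX : X.Nonempty)
    (hA : ∀ x ∈ X, A x ≠ 0) :
    ∃ (b : ℕ) (f : ℕ → ℝ) (Y : Finset ℝ) (σ : ℝ),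
      (∀ i ≤ b, f i ∈ X) ∧ (∀ i < b, f i < f (i + 1) ∧ A (f i) * A (f (i + 1)) < 0) ∧
      Y ⊆ X ∧ Y.card = b ∧ (σ = 1 ∨ σ = -1) ∧ 0 < σ * (-1) ^ b * A (f b) ∧
      ∀ x ∈ X, 0 < σ * (-1) ^ (Y.filter (· ≤ x)).card * A x := by
  induction X using Finset.induction_on_max with
  | empty => simp at hX
  | insert a X ha ih =>
    rcases X.eq_empty_or_nonempty with rfl | hne
    · have ha0 := hA a (by simp)
      rcases ha0.lt_or_gt with h | h
      · exact ⟨0, fun _ => a, ∅, -1, by simp, by simp, by simp, by simp, by simp, by simpa using h,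
          by simpa using h⟩
      · exact ⟨0, fun _ => a, ∅, 1, by simp, by simp, by simp, by simp, by simp, by simpa using h,
          by simpa using h⟩
    obtain ⟨b, f, Y, σ, hfX, hf, hYX, hYb, hσ, hb, hs⟩ :=
      ih hne fun x hx => hA x (Finset.mem_insert_of_mem hx)
    have hYa : ∀ y ∈ Y, y < a := fun y hy => ha y (hYX hy)
    have hne0 : σ * (-1) ^ b * A a ≠ 0 := by
      have h1 : σ ≠ 0 := by rcases hσ with rfl | rfl <;> norm_num
      exact mul_ne_zero (mul_ne_zero h1 (pow_ne_zero _ (by norm_num))) (hA a (by simp))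
    rcases hne0.lt_or_gt with hlt | hgt
    · refine ⟨b + 1, fun i => if i ≤ b then f i else a, insert a Y, σ, ?_, ?_, ?_, ?_, hσ, ?_, ?_⟩
      · intro i _
        dsimp only
        split_ifs with hi
        · exact Finset.mem_insert_of_mem (hfX i hi)
        · simp
      · intro i hi
        have hib : i ≤ b := by omega
        rcases hib.eq_or_lt with rfl | hib'
        · simp only [le_refl, if_true, show ¬ i + 1 ≤ i by omega, if_false]
          refine ⟨ha _ (hfX i le_rfl), ?_⟩
          have h3 := mul_neg_of_pos_of_neg hb hlt
          have h4 : (σ * (-1) ^ i) ^ 2 = 1 := by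
            rw [mul_pow, ← pow_mul, mul_comm i 2, pow_mul]
            rcases hσ with rfl | rfl <;> norm_num
          nlinarith
        · simpa [hib, show i + 1 ≤ b by omega] using hf i hib'
      · exact Finset.insert_subset_insert _ hYX
      · rw [Finset.card_insert_of_notMem fun h => (hYa a h).false, hYb]
      · simp only [show ¬ b + 1 ≤ b by omega, if_false, pow_succ]
        linarith
      · intro x hx
        rcases Finset.mem_insert.1 hx with rfl | hx
        · rw [Finset.filter_true_of_mem, Finset.card_insert_of_notMem fun h => (hYa x h).false,
            hYb, pow_succ]
          · linarith
          · intro y hy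
            rcases Finset.mem_insert.1 hy with rfl | hy
            · exact le_rfl
            · exact (hYa y hy).le
        · rw [Finset.filter_insert, if_neg (not_le.2 (ha x hx))]
          exact hs x hx
    · refine ⟨b, f, Y, σ, fun i hi => Finset.mem_insert_of_mem (hfX i hi), hf,
        hYX.trans (Finset.subset_insert _ _), hYb, hσ, hb, ?_⟩
      intro x hx
      rcases Finset.mem_insert.1 hx with rfl | hx
      · rwa [Finset.filter_true_of_mem fun y hy => (hYa y hy).le, hYb]
      · exact hs x hx

namespace IsTchebychevOn

theorem exists_nonneg_on_finset {k : ℕ} {φ : Fin (k + 1) → ℝ → ℝ} {Δ : Set ℝ}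
    (h : IsTchebychevOn φ Δ) (hΔ : Δ.OrdConnected) (hφ : ∀ i, ContinuousOn (φ i) Δ)
    (hinf : Δ.Infinite) {A : ℝ → ℝ}
    (hA : ¬ ∃ x : Fin (k + 2) → ℝ, StrictMono x ∧ (∀ i, x i ∈ interior Δ) ∧
      ∀ i : Fin (k + 1), A (x i.castSucc) * A (x i.succ) < 0)
    (X : Finset ℝ) (hX : ∀ x ∈ X, x ∈ interior Δ) :
    ∃ c : Fin (k + 1) → ℝ, c ≠ 0 ∧ ∀ x ∈ X, 0 ≤ (∑ i, c i * φ i x) * A x := by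
  set X' := X.filter (A · ≠ 0) with hX'
  rcases X'.eq_empty_or_nonempty with hemp | hne
  · refine ⟨1, one_ne_zero, fun x hx => ?_⟩
    have : A x = 0 := by
      by_contra h0
      have : x ∈ X' := Finset.mem_filter.2 ⟨hx, h0⟩
      simp [hemp] at this
    simp [this]
  obtain ⟨b, f, Y, σ, hfX, hf, hYX, hYb, hσ, -, hs⟩ :=
    exists_alternating_separating A X' hne fun x hx => (Finset.mem_filter.1 hx).2
  have hX'Δ : ∀ x ∈ X', x ∈ interior Δ := fun x hx => hX x (Finset.mem_filter.1 hx).1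
  have hbk : b ≤ k := by
    by_contra! hlt
    refine hA ⟨fun i => f i, Fin.strictMono_iff_lt_succ.2 fun i => ?_, fun i => ?_, fun i => ?_⟩
    · exact (hf i (by omega)).1
    · exact hX'Δ _ (hfX i (by omega))
    · exact (hf i (by omega)).2
  have hM : X'.max' hne ∈ interior Δ := hX'Δ _ (X'.max'_mem hne)
  have hIinf : (interior Δ ∩ Set.Ioi (X'.max' hne)).Infinite := by
    have : interior Δ ∩ Set.Ioi (X'.max' hne) ∈ nhdsWithin (X'.max' hne) (Set.Ioi (X'.max' hne)) :=
      
      Filter.inter_mem (mem_nhdsWithin_of_mem_nhds (isOpen_interior.mem_nhds hM)) self_mem_nhdsWithin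
    obtain ⟨u, hu, hsub⟩ := (mem_nhdsGT_iff_exists_Ioo_subset).1 this
    exact (Set.Ioo_infinite hu).mono hsub
  obtain ⟨E, hE, hEcard⟩ := hIinf.exists_subset_card_eq (k - b)
  have hEgt : ∀ e ∈ E, ∀ x ∈ X', x < e := fun e he x hx =>
    (X'.le_max' x hx).trans_lt (hE he).2
  have hdisj : Disjoint Y E := Finset.disjoint_left.2 fun y hy he => (hEgt y he y (hYX hy)).false
  obtain ⟨c, hc, hc0, hcpos⟩ := h.exists_sign_changes hΔ hφ hinf (Y := Y ∪ E)
    (by rw [Finset.card_union_of_disjoint hdisj, hYb, hEcard]; omega)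
    (by
      intro y hy
      rcases Finset.mem_union.1 hy with hy | hy
      · exact interior_subset (hX'Δ y (hYX hy))
      · exact interior_subset (hE hy).1)
  refine ⟨σ • c, smul_ne_zero (by rcases hσ with rfl | rfl <;> norm_num) hc, fun x hx => ?_⟩
  simp only [Pi.smul_apply, smul_eq_mul, mul_assoc, ← Finset.mul_sum]
  by_cases hA0 : A x = 0
  · simp [hA0]
  have hxX' : x ∈ X' := Finset.mem_filter.2 ⟨hx, hA0⟩
  by_cases hxY : x ∈ Y ∪ E
  · simp [hc0 x hxY]
  have h1 := hcpos x (interior_subset (hX x hx)) hxY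
  have h2 := hs x hxX'
  have hfil : (Y ∪ E).filter (· < x) = Y.filter (· ≤ x) := by
    ext y
    simp only [Finset.mem_filter, Finset.mem_union]
    constructor
    · rintro ⟨hy | hy, hyx⟩
      · exact ⟨hy, hyx.le⟩
      · exact ((hEgt y hy x hxX').not_gt hyx).elim
    · rintro ⟨hy, hyx⟩
      refine ⟨Or.inl hy, lt_of_le_of_ne hyx ?_⟩
      rintro rfl
      exact hxY (Finset.mem_union_left _ hy)
  rw [hfil] at h1
  have h3 := mul_pos h1 h2
  have h4 : ((-1 : ℝ) ^ (Y.filter (· ≤ x)).card) ^ 2 = 1 := by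
    rw [← pow_mul, mul_comm, pow_mul]; norm_num
  nlinarith

theorem exists_nonneg {k : ℕ} {φ : Fin (k + 1) → ℝ → ℝ} {Δ : Set ℝ}
    (h : IsTchebychevOn φ Δ) (hΔ : Δ.OrdConnected) (hφ : ∀ i, ContinuousOn (φ i) Δ)
    (hint : (interior Δ).Nonempty) (hinf : Δ.Infinite) {A : ℝ → ℝ} (hAc : ContinuousOn A Δ)
    (hA : ¬ ∃ x : Fin (k + 2) → ℝ, StrictMono x ∧ (∀ i, x i ∈ interior Δ) ∧
      ∀ i : Fin (k + 1), A (x i.castSucc) * A (x i.succ) < 0) :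
    ∃ c : Fin (k + 1) → ℝ, c ≠ 0 ∧ ∀ x ∈ Δ, 0 ≤ (∑ i, c i * φ i x) * A x := by
  obtain ⟨c, hcs, hc⟩ := (isCompact_sphere (0 : Fin (k + 1) → ℝ) 1).inter_iInter_nonempty
    (fun x : interior Δ => {c : Fin (k + 1) → ℝ | 0 ≤ (∑ i, c i * φ i x) * A x})
    (fun x => isClosed_le continuous_const (by fun_prop)) (by
      intro U
      obtain ⟨c, hc, hcU⟩ := h.exists_nonneg_on_finset hΔ hφ hinf hA (U.image Subtype.val)
        (by
          intro x hx
          obtain ⟨y, -, rfl⟩ := Finset.mem_image.1 hx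
          exact y.2)
      refine ⟨‖c‖⁻¹ • c, by simp [norm_smul, hc], ?_⟩
      simp only [Set.mem_iInter, Set.mem_ofPred_eq]
      intro x hx
      have := hcU x (Finset.mem_image_of_mem _ hx)
      simp only [Pi.smul_apply, smul_eq_mul, mul_assoc, ← Finset.mul_sum]
      positivity)
  simp only [Set.mem_iInter, Set.mem_ofPred_eq] at hc
  refine ⟨c, ?_, fun x hx => ?_⟩
  · rintro rfl
    simp at hcs
  have hcl : x ∈ closure (interior Δ) := by
    rw [(hΔ.convex (𝕜 := ℝ)).closure_interior_eq_closure_of_nonempty_interior hint]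
    exact subset_closure hx
  have hcont : ContinuousOn (fun x => (∑ i, c i * φ i x) * A x) Δ := by fun_prop
  exact continuousWithinAt_const.closure_le hcl ((hcont x hx).mono interior_subset)
    fun y hy => hc ⟨y, hy⟩

theorem exists_eq_zero_on_finset_ne_zero {k : ℕ} {φ : Fin (k + 1) → ℝ → ℝ} {Δ : Set ℝ}
    (h : IsTchebychevOn φ Δ) (hΔ : Δ.OrdConnected) (hφ : ∀ i, ContinuousOn (φ i) Δ)
    (hinf : Δ.Infinite) {F : Finset ℝ} (hF : F.card ≤ k) (hFΔ : ∀ x ∈ F, x ∈ Δ)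
    {a : ℝ} (ha : a ∈ Δ) (haF : a ∉ F) :
    ∃ c : Fin (k + 1) → ℝ, (∀ x ∈ F, ∑ i, c i * φ i x = 0) ∧ ∑ i, c i * φ i a ≠ 0 := by
  obtain ⟨E, hE, hEcard⟩ := (hinf.sdiff (insert a F).finite_toSet).exists_subset_card_eq (k - F.card)
  have hE' : ∀ e ∈ E, e ∈ Δ ∧ e ≠ a ∧ e ∉ F := fun e he => by simpa using hE he
  have hdisj : Disjoint F E := Finset.disjoint_left.2 fun y hy he => (hE' y he).2.2 hy
  obtain ⟨c, -, hc0, hc⟩ := h.exists_sign_changes hΔ hφ hinf (Y := F ∪ E)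
    (by rw [Finset.card_union_of_disjoint hdisj, hEcard]; omega)
    (by
      intro y hy
      rcases Finset.mem_union.1 hy with hy | hy
      · exact hFΔ y hy
      · exact (hE' y hy).1)
  refine ⟨c, fun x hx => hc0 x (Finset.mem_union_left _ hx), fun h0 => ?_⟩
  have := hc a ha (by
    rw [Finset.mem_union]
    rintro (hy | hy)
    · exact haF hy
    · exact (hE' a hy).2.1 rfl)
  simp [h0] at this

theorem exists_alternating_of_orthogonal {k : ℕ} {φ : Fin (k + 1) → ℝ → ℝ} {Δ : Set ℝ}
    (h : IsTchebychevOn φ Δ) (hΔ : Δ.OrdConnected) (hφ : ∀ i, ContinuousOn (φ i) Δ)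
    (hint : (interior Δ).Nonempty) (hinf : Δ.Infinite) {s : Measure ℝ} (hsΔ : s Δᶜ = 0)
    {A : ℝ → ℝ} (hAc : ContinuousOn A Δ) (hA0 : ¬ ∀ᵐ x ∂s, A x = 0)
    (horth : ∀ c : Fin (k + 1) → ℝ, Integrable (fun x => (∑ i, c i * φ i x) * A x) s ∧
      ∫ x, (∑ i, c i * φ i x) * A x ∂s = 0) :
    ∃ x : Fin (k + 2) → ℝ, StrictMono x ∧ (∀ i, x i ∈ interior Δ) ∧
      ∀ i : Fin (k + 1), A (x i.castSucc) * A (x i.succ) < 0 := by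
  by_contra hA
  have hΔae : ∀ᵐ x ∂s, x ∈ Δ := mem_ae_iff.2 hsΔ
  have hvanish : ∀ c : Fin (k + 1) → ℝ, (∀ᵐ x ∂s, 0 ≤ (∑ i, c i * φ i x) * A x) →
      ∀ᵐ x ∂s, (∑ i, c i * φ i x) * A x = 0 := fun c hc =>
    (integral_eq_zero_iff_of_nonneg_ae hc (horth c).1).1 (horth c).2
  obtain ⟨c, hc, hcpos⟩ := h.exists_nonneg hΔ hφ hint hinf hAc hA
  have hcA := hvanish c (hΔae.mono hcpos)
  set Z : Set ℝ := {x | x ∈ Δ ∧ ∑ i, c i * φ i x = 0} with hZdef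
  have hZ : Z.Finite := by
    by_contra hZ
    obtain ⟨S, hS, hcard⟩ := Set.Infinite.exists_subset_card_eq hZ (k + 1)
    exact (h c hc S fun x hx => hS hx).ne hcard
  set F := hZ.toFinset with hF
  have hFZ : ∀ x, x ∈ F ↔ x ∈ Z := fun x => hZ.mem_toFinset
  have hFcard : F.card < k + 1 := h c hc F fun x hx => (hFZ x).1 hx
  have hAF : ∀ᵐ x ∂s, x ∈ Δ ∧ (x ∉ F → A x = 0) := by
    filter_upwards [hΔae, hcA] with x hx hx0
    exact ⟨hx, fun hxF => (mul_eq_zero.1 hx0).resolve_left fun h0 => hxF ((hFZ x).2 ⟨hx, h0⟩)⟩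
  have hpt : ∀ a ∈ F, ∀ᵐ x ∂s, x = a → A x = 0 := by
    intro a ha
    obtain ⟨d, hd0, hda⟩ := h.exists_eq_zero_on_finset_ne_zero hΔ hφ hinf (F := F.erase a)
      ((Finset.card_erase_le).trans (by omega))
      (fun x hx => ((hFZ x).1 (Finset.mem_of_mem_erase hx)).1) ((hFZ a).1 ha).1
      (Finset.notMem_erase a F)
    set v := (∑ i, d i * φ i a) * A a with hv
    have hform : ∀ x, ∑ i, (v • d) i * φ i x = v * ∑ i, d i * φ i x := fun x => by
      simp only [Pi.smul_apply, smul_eq_mul, mul_assoc, ← Finset.mul_sum]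
    have hzero := hvanish (v • d) (by
      filter_upwards [hAF] with x hx
      rw [hform]
      by_cases hxa : x = a
      · rw [hxa, mul_assoc, ← hv]
        exact mul_self_nonneg v
      · by_cases hxF : x ∈ F
        · rw [hd0 x (Finset.mem_erase.2 ⟨hxa, hxF⟩)]
          simp
        · rw [hx.2 hxF, mul_zero])
    filter_upwards [hzero] with x hx hxa
    rw [hform, hxa, mul_assoc, ← hv, mul_self_eq_zero, hv] at hx
    rw [hxa]
    exact (mul_eq_zero.1 hx).resolve_left hda
  have hall : ∀ᵐ x ∂s, ∀ a ∈ F, x = a → A x = 0 := (Finset.eventually_all F).2 hpt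
  refine hA0 ?_
  filter_upwards [hAF, hall] with x hx hx'
  by_cases hxF : x ∈ F
  · exact hx' x hxF rfl
  · exact hx.2 hxF

end IsTchebychevOn

theorem infinite_of_infinite_msupport {s : Measure ℝ} (hinf : (msupport s).Infinite) {Δ : Set ℝ}
    (hsΔ : s Δᶜ = 0) : Δ.Infinite := by
  intro hfin
  refine hinf (hfin.subset fun x hx => ?_)
  by_contra hxΔ
  exact hx _ (hfin.isClosed.isOpen_compl.mem_nhds hxΔ) hsΔ

theorem nonempty_interior_of_infinite {Δ : Set ℝ} (hΔ : Δ.OrdConnected) (hinf : Δ.Infinite) :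
    (interior Δ).Nonempty := by
  obtain ⟨a, ha, b, hb, hab⟩ := hinf.nontrivial.exists_lt
  obtain ⟨c, hc⟩ := exists_between hab
  exact ⟨c, interior_maximal (Ioo_subset_Icc_self.trans (hΔ.out ha hb)) isOpen_Ioo hc⟩

/-- Zero counting for forms orthogonal with respect to an AT-system.  Let
`u₀,…,u_m` be continuous on an interval `Δ` forming an AT-system for the multi-index
`n` (every nontrivial form `Σ p_k u_k`, `deg p_k ≤ n_k − 1`, has at most `|n|−1`
zeros on `Δ`).  Let `s` be a positive measure on `Δ` with infinitely many support
points and `A` continuous on `Δ`, not `s`-a.e. zero, satisfying `∫ L·A ds = 0` for all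
such forms `L`.  If `A` has only finitely many sign changes on the interior of `Δ`,
then it has at least `|n|` sign changes there. -/
theorem stmt11 (Δ : Set ℝ) (hΔ : Δ.OrdConnected) (m : ℕ)
    (u : Fin (m + 1) → ℝ → ℝ) (hu : ∀ k, ContinuousOn (u k) Δ)
    (n : Fin (m + 1) → ℕ)
    (hAT : ∀ p : Fin (m + 1) → Polynomial ℝ,
      (∀ k, (p k).degree < (n k : WithBot ℕ)) → (¬ ∀ k, p k = 0) →
      ∀ S : Finset ℝ, (∀ x ∈ S, x ∈ Δ ∧ (∑ k, (p k).eval x * u k x) = 0) →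
        S.card ≤ (∑ k, n k) - 1)
    (s : Measure ℝ) [IsFiniteMeasure s] (hsΔ : s Δᶜ = 0)
    (hinf : (msupport s).Infinite)
    (A : ℝ → ℝ) (hA : ContinuousOn A Δ)
    (hA0 : ¬ (∀ᵐ x ∂s, A x = 0))
    (horth : ∀ p : Fin (m + 1) → Polynomial ℝ,
      (∀ k, (p k).degree < (n k : WithBot ℕ)) →
      Integrable (fun x => (∑ k, (p k).eval x * u k x) * A x) s ∧
        ∫ x, (∑ k, (p k).eval x * u k x) * A x ∂s = 0)
    (hfinchanges : ∃ K : ℕ, ∀ x : Fin (K + 1) → ℝ, StrictMono x →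
      (∀ i, x i ∈ interior Δ) →
      ¬ (∀ i : Fin K, A (x i.castSucc) * A (x i.succ) < 0)) :
    ∃ x : Fin ((∑ k, n k) + 1) → ℝ, StrictMono x ∧
      (∀ i, x i ∈ interior Δ) ∧
      ∀ i : Fin (∑ k, n k), A (x i.castSucc) * A (x i.succ) < 0 := by
  have hΔinf := infinite_of_infinite_msupport hinf hsΔ
  have hint := nonempty_interior_of_infinite hΔ hΔinf
  have e : (Σ k, Fin (n k)) ≃ Fin (∑ k, n k) := finSigmaFinEquiv
  clear hfinchanges
  generalize (∑ k, n k) = N at *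
  rcases N with _ | N
  · obtain ⟨x₀, hx₀⟩ := hint
    exact ⟨fun _ => x₀, Subsingleton.strictMono (α := Fin 1) _, fun _ => hx₀, fun i => i.elim0⟩
  let φ : Fin (N + 1) → ℝ → ℝ := fun i x => x ^ ((e.symm i).2 : ℕ) * u (e.symm i).1 x
  let p : (Fin (N + 1) → ℝ) → Fin (m + 1) → ℝ[X] := fun c k =>
    ∑ j : Fin (n k), C (c (e ⟨k, j⟩)) * X ^ (j : ℕ)
  have hp : ∀ c k, (p c k).degree < (n k : WithBot ℕ) := fun c k => degree_sum_fin_lt _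
  have hform : ∀ c x, ∑ k, (p c k).eval x * u k x = ∑ i, c i * φ i x := by
    intro c x
    have hφ : ∀ q, φ (e q) x = x ^ (q.2 : ℕ) * u q.1 x := fun q => by
      simp only [φ]
      rw [e.symm_apply_apply]
    rw [← e.sum_comp, Fintype.sum_sigma]
    refine Finset.sum_congr rfl fun k _ => ?_
    simp [p, hφ, eval_finsetSum, Finset.sum_mul, mul_assoc]
  have hT : IsTchebychevOn φ Δ := by
    intro c hc S hS
    refine Nat.lt_succ_of_le (hAT (p c) (hp c) (fun h0 => hc ?_) S fun x hx => ?_)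
    · ext i
      obtain ⟨⟨k, j⟩, rfl⟩ := e.surjective i
      have := congrArg (fun q => q.coeff (j : ℕ)) (h0 k)
      simpa [p, finsetSum_coeff, coeff_X_pow, Fin.val_inj] using this
    · rw [hform]
      exact hS x hx
  refine hT.exists_alternating_of_orthogonal hΔ (fun i => ?_) hint hΔinf hsΔ hA hA0 fun c => ?_
  · exact (continuousOn_id.pow _).mul (hu _)
  · simpa only [hform] using horth (p c) (hp c)
end

section
/- Let w be holomorphic on ℂ \ [a,∞) with sup_{z ∈ C_{R,θ,1}} |w(z)| = O(1/R) as R → ∞ and sup_{z ∈ C_{ε,θ,1}} |(z−a)w(z)| = o(1) as ε → 0, where C_{r,θ,1} = {a + re^{it} : θ ≤ t ≤ 2π−θ} and θ ∈ (0,π) is fixed. Then for every compact K ⊂ ℂ \ [a,∞) lying to the left of the contour Γ_θ = {a + te^{±iθ} : t ≥ 0}, the Cauchy integral representation w(z) = (1/2πi)·lim_{ε→0,R→∞} ∫_{Γ_{ε,R,θ}} w(ζ)/(ζ−z) dζ holds for all z ∈ K. -/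
open Filter Set intervalIntegral

/-- The complement of the ray `[a, ∞)` in the complex plane. -/
def slitDomain (a : ℝ) : Set ℂ := {z : ℂ | ¬ (z.im = 0 ∧ a ≤ z.re)}

theorem isOpen_slitDomain (a : ℝ) : IsOpen (slitDomain a) := by
  rw [← isClosed_compl_iff]
  have : (slitDomain a)ᶜ = {z : ℂ | z.im = 0} ∩ {z : ℂ | a ≤ z.re} := by
    ext z; simp [slitDomain]
  rw [this]
  exact (isClosed_eq Complex.continuous_im continuous_const).inter
    (isClosed_le continuous_const Complex.continuous_re)

theorem add_mul_exp_mem_slitDomain (a : ℝ) {r t : ℝ} (hr : 0 < r) (ht : t ∈ Ioo 0 (2 * Real.pi)) :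
    (a : ℂ) + r * Complex.exp (Complex.I * t) ∈ slitDomain a := by
  rintro ⟨h₁, h₂⟩
  simp only [Complex.add_im, Complex.add_re, Complex.ofReal_im, Complex.ofReal_re,
    Complex.re_ofReal_mul, Complex.im_ofReal_mul, mul_comm Complex.I,
    Complex.exp_ofReal_mul_I_re, Complex.exp_ofReal_mul_I_im, zero_add] at h₁ h₂
  have hs : Real.sin t = 0 := by simpa [hr.ne'] using h₁
  have hc : 0 ≤ Real.cos t := by
    by_contra! h
    nlinarith
  have hcos : Real.cos t = 1 := by nlinarith [Real.sin_sq_add_cos_sq t]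
  exact ht.1.ne' ((Real.cos_eq_one_iff_of_lt_of_lt (by linarith [ht.1, Real.pi_pos]) ht.2).1 hcos)

theorem exp_two_pi_sub (θ : ℝ) :
    Complex.exp (Complex.I * ((2 * Real.pi - θ : ℝ) : ℂ)) = Complex.exp (-(Complex.I * θ)) := by
  rw [← Complex.exp_periodic (-(Complex.I * (θ : ℂ)))]
  congr 1
  push_cast
  ring

theorem integral_mul_comp_exp {ε R : ℝ} (hε : 0 < ε) (hR : 0 < R) (a : ℝ) (c : ℂ) {F : ℂ → ℂ}
    (hF : ∀ t : ℝ, 0 < t → ContinuousAt F (a + t * c)) :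
    ∫ x in Real.log ε..Real.log R, Complex.exp x * c * F (a + Complex.exp x * c) =
      ∫ t in ε..R, c * F (a + t * c) := by
  have key := intervalIntegral.integral_deriv_smul_comp' (a := Real.log ε) (b := Real.log R)
    (f := Real.exp) (f' := Real.exp) (g := fun t : ℝ => c * F (a + t * c))
    (fun x _ => Real.hasDerivAt_exp x) Real.continuous_exp.continuousOn
    (by
      rintro _ ⟨x, -, rfl⟩
      have h : ContinuousAt (fun t : ℝ => (a : ℂ) + t * c) (Real.exp x) := by fun_prop
      exact (continuousAt_const.mul
        (ContinuousAt.comp (f := fun t : ℝ => (a : ℂ) + t * c) (hF _ (Real.exp_pos x)) h)).continuousWithinAt)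
  rw [Real.exp_log hε, Real.exp_log hR] at key
  rw [← key]
  refine intervalIntegral.integral_congr fun x _ => ?_
  simp [mul_assoc]

/-- Cauchy's theorem for the boundary of a sectorial annulus that avoids `[a, ∞)`. -/
theorem integral_rays_eq_sub_arcs {a θ : ℝ} (hθ : θ ∈ Ioo 0 Real.pi) {F : ℂ → ℂ}
    (hF : DifferentiableOn ℂ F (slitDomain a)) {ε R : ℝ} (hε : 0 < ε) (hR : 0 < R) :
    (∫ t in ε..R, (Complex.exp (Complex.I * θ) * F (a + t * Complex.exp (Complex.I * θ)) -
      Complex.exp (-(Complex.I * θ)) * F (a + t * Complex.exp (-(Complex.I * θ))))) =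
    Complex.I * (∫ s in θ..(2 * Real.pi - θ),
      ε * Complex.exp (Complex.I * s) * F (a + ε * Complex.exp (Complex.I * s))) -
    Complex.I * (∫ s in θ..(2 * Real.pi - θ),
      R * Complex.exp (Complex.I * s) * F (a + R * Complex.exp (Complex.I * s))) := by
  obtain ⟨hθ₀, hθπ⟩ := hθ
  have hmem : ∀ s ∈ Icc θ (2 * Real.pi - θ), ∀ r : ℝ, 0 < r →
      (a : ℂ) + r * Complex.exp (Complex.I * s) ∈ slitDomain a := fun s hs r hr =>
    add_mul_exp_mem_slitDomain a hr ⟨by linarith [hs.1], by linarith [hs.2]⟩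
  have hcont : ∀ s ∈ Icc θ (2 * Real.pi - θ), ∀ r : ℝ, 0 < r →
      ContinuousAt F (a + r * Complex.exp (Complex.I * s)) := fun s hs r hr =>
    (hF.differentiableAt ((isOpen_slitDomain a).mem_nhds (hmem s hs r hr))).continuousAt
  have h₁ : θ ∈ Icc θ (2 * Real.pi - θ) := ⟨le_rfl, by linarith⟩
  have h₂ : 2 * Real.pi - θ ∈ Icc θ (2 * Real.pi - θ) := ⟨by linarith, le_rfl⟩
  have hH : DifferentiableOn ℂ (fun u => Complex.exp u * F (a + Complex.exp u))
      (uIcc (Real.log ε) (Real.log R) ×ℂ uIcc θ (2 * Real.pi - θ)) := by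
    refine Complex.differentiable_exp.differentiableOn.mul
      (hF.comp (by fun_prop) fun u hu => ?_)
    rw [uIcc_of_le h₁.2] at hu
    have := hmem u.im hu.2 (Real.exp u.re) (Real.exp_pos _)
    rwa [Complex.ofReal_exp, ← Complex.exp_add, mul_comm Complex.I, Complex.re_add_im] at this
  have hrect := Complex.integral_boundary_rect_eq_zero_of_differentiableOn
    (fun u => Complex.exp u * F (a + Complex.exp u))
    ⟨Real.log ε, θ⟩ ⟨Real.log R, 2 * Real.pi - θ⟩ hH
  have hc₁ := hcont θ h₁
  have hc₂ := hcont _ h₂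
  have e₁ := integral_mul_comp_exp hε hR a _ hc₁
  have e₂ := integral_mul_comp_exp hε hR a _ hc₂
  have hlog : ∀ r : ℝ, 0 < r → Complex.exp (Real.log r : ℂ) = r := fun r hr => by
    rw [← Complex.ofReal_exp, Real.exp_log hr]
  simp only [Complex.exp_add, mul_comm _ Complex.I, hlog ε hε, hlog R hR, smul_eq_mul] at hrect
  have hint : ∀ s ∈ Icc θ (2 * Real.pi - θ), IntervalIntegrable
      (fun t : ℝ => Complex.exp (Complex.I * s) * F (a + t * Complex.exp (Complex.I * s)))
      MeasureTheory.volume ε R := fun s hs =>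
    ContinuousOn.intervalIntegrable fun t ht => by
      have ht₀ : 0 < t := (lt_min hε hR).trans_le ht.1
      have h : ContinuousAt (fun t : ℝ => (a : ℂ) + t * Complex.exp (Complex.I * s)) t := by
        fun_prop
      exact (continuousAt_const.mul (ContinuousAt.comp
        (f := fun t : ℝ => (a : ℂ) + t * Complex.exp (Complex.I * s))
        (hcont s hs t ht₀) h)).continuousWithinAt
  rw [← exp_two_pi_sub, intervalIntegral.integral_sub (hint _ h₁) (hint _ h₂), ← e₁, ← e₂]
  linear_combination hrect

theorem ofReal_add_mem_slitPlane {u : ℂ} (hu : u ∈ Complex.slitPlane) {t : ℝ} (ht : 0 ≤ t) :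
    (t : ℂ) + u ∈ Complex.slitPlane := by
  rw [Complex.mem_slitPlane_iff] at hu ⊢
  simp only [Complex.add_re, Complex.ofReal_re, Complex.add_im, Complex.ofReal_im, zero_add]
  exact hu.imp_left fun h => by linarith

theorem integral_inv_ofReal_add {u : ℂ} (hu : u ∈ Complex.slitPlane) {ε R : ℝ}
    (hε : 0 < ε) (hR : 0 < R) :
    (∫ t in ε..R, ((t : ℂ) + u)⁻¹) = Complex.log (R + u) - Complex.log (ε + u) := by
  have hpos : ∀ t ∈ uIcc ε R, 0 ≤ t := fun t ht => ((lt_min hε hR).trans_le ht.1).le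
  refine intervalIntegral.integral_eq_sub_of_hasDerivAt
    (f := fun t : ℝ => Complex.log (t + u)) (fun t ht => ?_) ?_
  · have h : HasDerivAt (fun t : ℝ => (t : ℂ) + u) 1 t :=
      (HasDerivAt.ofReal_comp (hasDerivAt_id t)).add_const u
    simpa using h.clog_real (ofReal_add_mem_slitPlane hu (hpos t ht))
  · refine ContinuousOn.intervalIntegrable (ContinuousOn.inv₀ (by fun_prop) fun t ht => ?_)
    exact Complex.slitPlane_ne_zero (ofReal_add_mem_slitPlane hu (hpos t ht))

theorem tendsto_log_ofReal_add_sub_log {u v : ℂ} :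
    Tendsto (fun R : ℝ => Complex.log (R + u) - Complex.log (R + v)) atTop (nhds 0) := by
  have h : ∀ u : ℂ, Tendsto (fun R : ℝ => Complex.log (R + u) - Real.log R) atTop (nhds 0) := by
    intro u
    have h₁ : Tendsto (fun R : ℝ => 1 + u / R) atTop (nhds 1) := by
      have := (tendsto_inv_atTop_zero (𝕜 := ℝ)).ofReal.const_mul u
      simpa [div_eq_mul_inv] using this.const_add 1
    have h₂ : Tendsto (fun R : ℝ => Complex.log (1 + u / R)) atTop (nhds 0) := by
      simpa using h₁.clog Complex.one_mem_slitPlane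
    refine h₂.congr' ?_
    filter_upwards [eventually_gt_atTop 0, h₁.eventually_ne one_ne_zero] with R hR hne
    have hR' : (R : ℂ) ≠ 0 := by exact_mod_cast hR.ne'
    rw [show (R : ℂ) + u = R * (1 + u / R) by field_simp, Complex.log_ofReal_mul hR hne]
    ring
  simpa using (h u).sub (h v)

theorem tendsto_intervalIntegral_of_norm_sub_le {ι : Type*} {l : Filter ι} {α β : ℝ} (hαβ : α ≤ β)
    {G : ι → ℝ → ℂ} {c : ℂ} (hG : ∀ᶠ p in l, ContinuousOn (G p) (Icc α β))
    (hc : ∀ δ > 0, ∀ᶠ p in l, ∀ s ∈ Icc α β, ‖G p s - c‖ ≤ δ) :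
    Tendsto (fun p => ∫ s in α..β, G p s) l (nhds ((β - α) * c)) := by
  rw [Metric.tendsto_nhds]
  intro δ hδ
  have hpos : 0 < β - α + 1 := by linarith
  filter_upwards [hG, hc (δ / (β - α + 1)) (by positivity)] with p hp hcp
  have hint : IntervalIntegrable (G p) MeasureTheory.volume α β :=
    ContinuousOn.intervalIntegrable (by rwa [uIcc_of_le hαβ])
  have : (∫ s in α..β, G p s) - (β - α) * c = ∫ s in α..β, (G p s - c) := by
    rw [intervalIntegral.integral_sub hint intervalIntegrable_const, intervalIntegral.integral_const]
    simp
  rw [dist_eq_norm, this]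
  have hle := intervalIntegral.norm_integral_le_of_norm_le_const (f := fun s => G p s - c)
    (a := α) (b := β) fun s hs => hcp s (by
      rw [uIoc_of_le hαβ] at hs
      exact Ioc_subset_Icc_self hs)
  rw [abs_of_nonneg (by linarith)] at hle
  refine hle.trans_lt ?_
  rw [div_mul_eq_mul_div, div_lt_iff₀ hpos]
  nlinarith

theorem exists_eq_mul_exp_of_lt_abs_arg {θ : ℝ} (hθ : θ ∈ Ioo 0 Real.pi) {v : ℂ}
    (hv : θ < |v.arg|) :
    ∃ φ ∈ Ioo θ (2 * Real.pi - θ), v = ‖v‖ * Complex.exp (Complex.I * φ) := by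
  obtain ⟨hθ₀, hθπ⟩ := hθ
  rcases lt_abs.1 hv with h | h
  · refine ⟨v.arg, ⟨h, by linarith [v.arg_le_pi]⟩, ?_⟩
    rw [mul_comm Complex.I, Complex.norm_mul_exp_arg_mul_I]
  · refine ⟨v.arg + 2 * Real.pi, ⟨by linarith [v.neg_pi_lt_arg], by linarith⟩, ?_⟩
    have : Complex.I * ((v.arg + 2 * Real.pi : ℝ) : ℂ) =
        v.arg * Complex.I + 2 * Real.pi * Complex.I := by push_cast; ring
    rw [this, Complex.exp_periodic, Complex.norm_mul_exp_arg_mul_I]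

theorem log_mul_exp {r ψ : ℝ} (hr : 0 < r) (hψ : ψ ∈ Ioo (-Real.pi) Real.pi) :
    Complex.log (r * Complex.exp (Complex.I * ψ)) = Real.log r + Complex.I * ψ := by
  rw [Complex.log_ofReal_mul hr (Complex.exp_ne_zero _), Complex.log_exp] <;>
    simp [hψ.1, hψ.2.le]

theorem mul_exp_mem_slitPlane {r ψ : ℝ} (hr : 0 < r) (hψ : ψ ∈ Ioo (-Real.pi) Real.pi) :
    (r : ℂ) * Complex.exp (Complex.I * ψ) ∈ Complex.slitPlane := by
  have hne : (r : ℂ) * Complex.exp (Complex.I * ψ) ≠ 0 :=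
    mul_ne_zero (by exact_mod_cast hr.ne') (Complex.exp_ne_zero _)
  refine Complex.mem_slitPlane_iff_arg.2 ⟨?_, hne⟩
  rw [← Complex.log_im, log_mul_exp hr hψ]
  simpa using hψ.2.ne

/-- The Cauchy kernel integrated along the two rays at angles `±θ`, seen from a point `v`
in the complementary sector. -/
theorem tendsto_integral_rays_kernel {θ : ℝ} (hθ : θ ∈ Ioo 0 Real.pi) {v : ℂ} (hv₀ : v ≠ 0)
    (hv : θ < |v.arg|) :
    Tendsto (fun p : ℝ × ℝ => ∫ t in p.1..p.2,
      (Complex.exp (Complex.I * θ) / (t * Complex.exp (Complex.I * θ) - v) -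
        Complex.exp (-(Complex.I * θ)) / (t * Complex.exp (-(Complex.I * θ)) - v)))
      ((nhdsWithin (0 : ℝ) (Ioi 0)) ×ˢ atTop) (nhds (2 * Complex.I * θ)) := by
  obtain ⟨φ, ⟨hφ₁, hφ₂⟩, hφ⟩ := exists_eq_mul_exp_of_lt_abs_arg hθ hv
  obtain ⟨hθ₀, hθπ⟩ := hθ
  have hr : 0 < ‖v‖ := norm_pos_iff.2 hv₀
  have hψ₁ : φ - θ - Real.pi ∈ Ioo (-Real.pi) Real.pi := ⟨by linarith, by linarith⟩
  have hψ₂ : φ + θ - Real.pi ∈ Ioo (-Real.pi) Real.pi := ⟨by linarith, by linarith⟩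
  have hu₁ := mul_exp_mem_slitPlane hr hψ₁
  have hu₂ := mul_exp_mem_slitPlane hr hψ₂
  have hl₁ := log_mul_exp hr hψ₁
  have hl₂ := log_mul_exp hr hψ₂
  have hneg : Complex.exp (Complex.I * Real.pi) = -1 := by
    rw [mul_comm]; exact Complex.exp_pi_mul_I
  have he₁ : Complex.exp (Complex.I * ((φ - θ - Real.pi : ℝ) : ℂ)) * Complex.exp (Complex.I * θ) =
      -Complex.exp (Complex.I * φ) := by
    have : Complex.I * (φ : ℂ) = Complex.I * ((φ - θ - Real.pi : ℝ) : ℂ) + Complex.I * θ +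
        Complex.I * Real.pi := by push_cast; ring
    rw [this, Complex.exp_add, Complex.exp_add, hneg]
    ring
  have he₂ : Complex.exp (Complex.I * ((φ + θ - Real.pi : ℝ) : ℂ)) *
      Complex.exp (-(Complex.I * θ)) = -Complex.exp (Complex.I * φ) := by
    have : Complex.I * (φ : ℂ) = Complex.I * ((φ + θ - Real.pi : ℝ) : ℂ) + -(Complex.I * θ) +
        Complex.I * Real.pi := by push_cast; ring
    rw [this, Complex.exp_add, Complex.exp_add, hneg]
    ring
  set u₁ := (‖v‖ : ℂ) * Complex.exp (Complex.I * ((φ - θ - Real.pi : ℝ) : ℂ)) with hu₁def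
  set u₂ := (‖v‖ : ℂ) * Complex.exp (Complex.I * ((φ + θ - Real.pi : ℝ) : ℂ)) with hu₂def
  have hk : ∀ e u : ℂ, e ≠ 0 → u * e = -v → ∀ t : ℝ, e / (t * e - v) = ((t : ℂ) + u)⁻¹ := by
    intro e u he hue t
    rw [show (t : ℂ) * e - v = (t + u) * e by linear_combination -hue, div_mul_cancel_right₀ he]
  have hk₁ := hk _ u₁ (Complex.exp_ne_zero _) (by
    rw [hu₁def, mul_assoc, he₁]; linear_combination hφ)
  have hk₂ := hk _ u₂ (Complex.exp_ne_zero _) (by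
    rw [hu₂def, mul_assoc, he₂]; linear_combination hφ)
  simp only [hk₁, hk₂]
  have hε : ∀ u ∈ Complex.slitPlane,
      Tendsto (fun t : ℝ => Complex.log (t + u)) (nhdsWithin 0 (Ioi 0)) (nhds (Complex.log u)) := by
    intro u hu
    have : Tendsto (fun t : ℝ => (t : ℂ) + u) (nhdsWithin 0 (Ioi 0)) (nhds u) := by
      have h : Continuous fun t : ℝ => (t : ℂ) + u := by fun_prop
      simpa using (h.tendsto 0).mono_left nhdsWithin_le_nhds
    exact this.clog hu
  have hlim := ((tendsto_log_ofReal_add_sub_log (u := u₁) (v := u₂)).comp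
    (tendsto_snd (f := nhdsWithin (0 : ℝ) (Ioi 0)))).sub
      (((hε u₁ hu₁).sub (hε u₂ hu₂)).comp (tendsto_fst (g := (atTop : Filter ℝ))))
  have hval : 0 - (Complex.log u₁ - Complex.log u₂) = 2 * Complex.I * θ := by
    rw [hl₁, hl₂]; push_cast; ring
  rw [hval] at hlim
  refine hlim.congr' ?_
  filter_upwards [(eventually_mem_nhdsWithin (a := (0 : ℝ)) (s := Ioi 0)).prod_mk
    (eventually_gt_atTop (0 : ℝ))] with p hp
  have hint : ∀ u ∈ Complex.slitPlane,
      IntervalIntegrable (fun t : ℝ => ((t : ℂ) + u)⁻¹) MeasureTheory.volume p.1 p.2 := by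
    refine fun u hu => ContinuousOn.intervalIntegrable
      (ContinuousOn.inv₀ (by fun_prop) fun t ht => ?_)
    exact Complex.slitPlane_ne_zero
      (ofReal_add_mem_slitPlane hu ((lt_min hp.1 hp.2).trans_le ht.1).le)
  rw [intervalIntegral.integral_sub (hint _ hu₁) (hint _ hu₂),
    integral_inv_ofReal_add hu₁ hp.1 hp.2, integral_inv_ofReal_add hu₂ hp.1 hp.2]
  simp only [Function.comp]
  ring

theorem norm_ofReal_mul_exp {r : ℝ} (hr : 0 < r) (t : ℝ) :
    ‖(r : ℂ) * Complex.exp (Complex.I * t)‖ = r := by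
  simp [mul_comm Complex.I, Complex.norm_exp_ofReal_mul_I, hr.le]

theorem continuousOn_sector_arc {a θ : ℝ} (hθ : θ ∈ Ioo 0 Real.pi) {F : ℂ → ℂ}
    (hF : DifferentiableOn ℂ F (slitDomain a)) {r : ℝ} (hr : 0 < r) :
    ContinuousOn (fun s : ℝ => r * Complex.exp (Complex.I * s) *
      F (a + r * Complex.exp (Complex.I * s))) (Icc θ (2 * Real.pi - θ)) :=
  ContinuousOn.mul (by fun_prop) <| hF.continuousOn.comp (by fun_prop) fun s hs =>
    add_mul_exp_mem_slitDomain a hr ⟨by linarith [hs.1, hθ.1], by linarith [hs.2, hθ.1]⟩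

/-- Formula (2.7) of Lemma 2.4 (Cauchy integral representation on a two-ray contour).
Let `w` be holomorphic on `ℂ \ [a,∞)` with `sup_{C_{R,θ,1}} |w| = O(1/R)` and
`sup_{C_{ε,θ,1}} |(z−a)w(z)| = o(1)`, where `C_{r,θ,1} = {a + r e^{it} : θ ≤ t ≤ 2π−θ}`.
Then for every compact `K ⊂ ℂ \ [a,∞)` lying to the left of
`Γ_θ = {a + t e^{±iθ} : t ≥ 0}` (i.e. `θ < |arg(z−a)|` on `K`) and every `z ∈ K`:
`w(z) = (2πi)⁻¹ · lim_{ε→0⁺,R→∞} ∫_{Γ_{ε,R,θ}} w(ζ)/(ζ−z) dζ`. -/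
theorem stmt19 (a θ : ℝ) (hθ : θ ∈ Set.Ioo 0 Real.pi) (w : ℂ → ℂ)
    (hol : DifferentiableOn ℂ w {z : ℂ | ¬ (z.im = 0 ∧ a ≤ z.re)})
    (hbigO : ∃ C R₀ : ℝ, ∀ R : ℝ, R₀ ≤ R → ∀ t ∈ Set.Icc θ (2 * Real.pi - θ),
      ‖w ((a : ℂ) + (R : ℂ) * Complex.exp (Complex.I * (t : ℂ)))‖ ≤ C / R)
    (hsmall : ∀ δ : ℝ, 0 < δ → ∃ ε₀ > (0 : ℝ), ∀ ε : ℝ, 0 < ε → ε < ε₀ →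
      ∀ t ∈ Set.Icc θ (2 * Real.pi - θ),
        ‖((ε : ℂ) * Complex.exp (Complex.I * (t : ℂ))) *
          w ((a : ℂ) + (ε : ℂ) * Complex.exp (Complex.I * (t : ℂ)))‖ ≤ δ)
    (K : Set ℂ) (hK : IsCompact K)
    (hKleft : ∀ z ∈ K, z ≠ (a : ℂ) ∧ θ < |Complex.arg (z - (a : ℂ))|) :
    ∀ z ∈ K,
      Tendsto (fun p : ℝ × ℝ =>
          (2 * (Real.pi : ℂ) * Complex.I)⁻¹ *
            ∫ t in p.1..p.2,
              (Complex.exp (Complex.I * (θ : ℂ)) *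
                  w ((a : ℂ) + (t : ℂ) * Complex.exp (Complex.I * (θ : ℂ))) /
                    ((a : ℂ) + (t : ℂ) * Complex.exp (Complex.I * (θ : ℂ)) - z) -
                Complex.exp (-(Complex.I * (θ : ℂ))) *
                  w ((a : ℂ) + (t : ℂ) * Complex.exp (-(Complex.I * (θ : ℂ)))) /
                    ((a : ℂ) + (t : ℂ) * Complex.exp (-(Complex.I * (θ : ℂ))) - z)))
        ((nhdsWithin (0 : ℝ) (Set.Ioi 0)) ×ˢ atTop) (nhds (w z)) := by
  intro z hz
  obtain ⟨hza, hzθ⟩ := hKleft z hz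
  have hθ₀ := hθ.1
  have hθπ := hθ.2
  set v := z - (a : ℂ) with hv
  have hv₀ : v ≠ 0 := sub_ne_zero.2 hza
  have hV : 0 < ‖v‖ := norm_pos_iff.2 hv₀
  have hzv : z = a + v := by rw [hv]; ring
  obtain ⟨φ, ⟨hφ₁, hφ₂⟩, hφ⟩ := exists_eq_mul_exp_of_lt_abs_arg hθ hzθ
  have hz_mem : z ∈ slitDomain a := by
    rw [hzv, hφ]
    exact add_mul_exp_mem_slitDomain a hV ⟨by linarith, by linarith⟩
  have hol' : DifferentiableOn ℂ w (slitDomain a) := hol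
  have hF : DifferentiableOn ℂ (dslope w z) (slitDomain a) :=
    (Complex.differentiableOn_dslope ((isOpen_slitDomain a).mem_nhds hz_mem)).2 hol'
  have hFeq : ∀ ζ : ℂ, ζ ≠ v → dslope w z (a + ζ) = (w (a + ζ) - w z) / (ζ - v) := by
    intro ζ hζ
    have hne : (a : ℂ) + ζ ≠ z := by rw [hzv]; simpa using hζ
    rw [dslope_of_ne _ hne, slope_def_field]
    congr 1
    rw [hv]; ring
  have hαβ : θ ≤ 2 * Real.pi - θ := by linarith
  obtain ⟨C, R₀, hC⟩ := hbigO
  have houter : Tendsto (fun R : ℝ => ∫ s in θ..(2 * Real.pi - θ),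
      R * Complex.exp (Complex.I * s) * dslope w z (a + R * Complex.exp (Complex.I * s))) atTop
      (nhds (((2 * Real.pi - θ : ℝ) - θ) * (-w z))) := by
    refine tendsto_intervalIntegral_of_norm_sub_le hαβ
      ((eventually_gt_atTop 0).mono fun R hR => continuousOn_sector_arc hθ hF hR) fun δ hδ => ?_
    filter_upwards [eventually_gt_atTop ‖v‖, eventually_ge_atTop R₀,
      eventually_ge_atTop (‖v‖ + (C + ‖w z‖ * ‖v‖) / δ)] with R hRv hR₀ hRM s hs
    have hR : 0 < R := hV.trans hRv
    have hnorm := norm_ofReal_mul_exp hR s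
    have hw := hC R hR₀ s hs
    set ζ := (R : ℂ) * Complex.exp (Complex.I * s)
    have hζ : ζ ≠ v := fun h => by rw [h] at hnorm; linarith
    have hζv : ζ - v ≠ 0 := sub_ne_zero.2 hζ
    rw [hFeq ζ hζ, show ζ * ((w (a + ζ) - w z) / (ζ - v)) - -w z =
      (ζ * w (a + ζ) - w z * v) / (ζ - v) by field_simp; ring, norm_div,
      div_le_iff₀ (norm_pos_iff.2 hζv)]
    have h₁ : ‖ζ * w (a + ζ) - w z * v‖ ≤ C + ‖w z‖ * ‖v‖ := by
      refine (norm_sub_le _ _).trans ?_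
      rw [norm_mul ζ (w _), norm_mul (w z), hnorm]
      rw [le_div_iff₀ hR] at hw
      linarith
    have h₂ : R - ‖v‖ ≤ ‖ζ - v‖ := hnorm ▸ norm_sub_norm_le ζ v
    have h₃ : C + ‖w z‖ * ‖v‖ ≤ (R - ‖v‖) * δ := by
      rw [← div_le_iff₀ hδ]; linarith
    nlinarith
  have hinner : Tendsto (fun ε : ℝ => ∫ s in θ..(2 * Real.pi - θ),
      ε * Complex.exp (Complex.I * s) * dslope w z (a + ε * Complex.exp (Complex.I * s)))
      (nhdsWithin 0 (Ioi 0)) (nhds (((2 * Real.pi - θ : ℝ) - θ) * 0)) := by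
    have hlt : ∀ c : ℝ, 0 < c → ∀ᶠ ε in nhdsWithin (0 : ℝ) (Ioi 0), ε < c := fun c hc =>
      nhdsWithin_le_nhds (eventually_lt_nhds hc)
    refine tendsto_intervalIntegral_of_norm_sub_le hαβ
      (eventually_mem_nhdsWithin.mono fun ε hε => continuousOn_sector_arc hθ hF hε) fun δ hδ => ?_
    obtain ⟨ε₀, hε₀, hsm⟩ := hsmall (δ * ‖v‖ / 4) (by positivity)
    filter_upwards [eventually_mem_nhdsWithin, hlt ε₀ hε₀, hlt (‖v‖ / 2) (by positivity),
      hlt (δ * ‖v‖ / (4 * (‖w z‖ + 1))) (by positivity)] with ε hε hεε₀ hεv hεM s hs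
    have hnorm := norm_ofReal_mul_exp hε s
    have hw := hsm ε hε hεε₀ s hs
    set ζ := (ε : ℂ) * Complex.exp (Complex.I * s)
    have hζ : ζ ≠ v := fun h => by rw [h] at hnorm; linarith
    have hζv : ζ - v ≠ 0 := sub_ne_zero.2 hζ
    rw [hFeq ζ hζ, show ζ * ((w (a + ζ) - w z) / (ζ - v)) - 0 =
      (ζ * w (a + ζ) - ζ * w z) / (ζ - v) by ring, norm_div,
      div_le_iff₀ (norm_pos_iff.2 hζv)]
    have h₁ : ‖ζ * w (a + ζ) - ζ * w z‖ ≤ δ * ‖v‖ / 4 + ε * ‖w z‖ := by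
      refine (norm_sub_le _ _).trans ?_
      rw [norm_mul ζ (w z), hnorm]
      linarith
    have h₂ : ‖v‖ - ε ≤ ‖ζ - v‖ := by
      rw [norm_sub_rev ζ v, ← hnorm]; exact norm_sub_norm_le v ζ
    have h₃ : ε * (4 * (‖w z‖ + 1)) < δ * ‖v‖ := (lt_div_iff₀ (by positivity)).1 hεM
    have hε' : 0 < ε := hε
    nlinarith
  have hlim := (((hinner.const_mul Complex.I).comp (tendsto_fst (g := (atTop : Filter ℝ)))).sub
    ((houter.const_mul Complex.I).comp (tendsto_snd (f := nhdsWithin (0 : ℝ) (Ioi 0))))).add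
    ((tendsto_integral_rays_kernel hθ hv₀ hzθ).const_mul (w z))
  have hlim' := hlim.const_mul (2 * (Real.pi : ℂ) * Complex.I)⁻¹
  have hπ : (Real.pi : ℂ) ≠ 0 := by exact_mod_cast Real.pi_ne_zero
  have hval : (2 * (Real.pi : ℂ) * Complex.I)⁻¹ *
      (Complex.I * (((2 * Real.pi - θ : ℝ) - θ) * 0) -
        Complex.I * (((2 * Real.pi - θ : ℝ) - θ) * (-w z)) + w z * (2 * Complex.I * θ)) = w z := by
    have hI := Complex.I_ne_zero
    field_simp
    push_cast
    ring
  rw [hval] at hlim'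
  refine hlim'.congr' ?_
  filter_upwards [(eventually_mem_nhdsWithin (a := (0 : ℝ)) (s := Ioi 0)).prod_mk
    (eventually_gt_atTop (0 : ℝ))] with p hp
  have hp₁ : 0 < p.1 := hp.1
  have hp₂ : 0 < p.2 := hp.2
  simp only [Function.comp]
  congr 1
  rw [← integral_rays_eq_sub_arcs hθ hF hp₁ hp₂, ← intervalIntegral.integral_const_mul]
  have hpos : ∀ t ∈ uIcc p.1 p.2, 0 < t := fun t ht => (lt_min hp₁ hp₂).trans_le ht.1
  have hne : ∀ α : ℝ, |α| = θ → ∀ t : ℝ, 0 < t → (t : ℂ) * Complex.exp (Complex.I * α) - v ≠ 0 := by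
    intro α hα t ht h
    have hα' := abs_lt.1 (hα.trans_lt hθπ)
    rw [← sub_eq_zero.1 h, Complex.arg_real_mul _ ht, mul_comm, Complex.arg_exp_mul_I,
      (toIocMod_eq_self Real.two_pi_pos).2 ⟨hα'.1, by linarith [hα'.2]⟩, hα] at hzθ
    exact hzθ.false
  have hmem : ∀ α : ℝ, |α| = θ → ∀ t : ℝ, 0 < t →
      (a : ℂ) + t * Complex.exp (Complex.I * α) ∈ slitDomain a := by
    intro α hα t ht
    rcases eq_or_eq_neg_of_abs_eq hα with rfl | rfl
    · exact add_mul_exp_mem_slitDomain a ht ⟨by linarith, by linarith⟩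
    · have := add_mul_exp_mem_slitDomain a (t := 2 * Real.pi - θ) ht ⟨by linarith, by linarith⟩
      rw [exp_two_pi_sub] at this
      simpa using this
  have hint₁ : ∀ α : ℝ, |α| = θ → IntervalIntegrable (fun t : ℝ => Complex.exp (Complex.I * α) *
      dslope w z (a + t * Complex.exp (Complex.I * α))) MeasureTheory.volume p.1 p.2 := fun α hα =>
    ContinuousOn.intervalIntegrable <| continuousOn_const.mul <|
      hF.continuousOn.comp (by fun_prop) fun t ht => hmem α hα t (hpos t ht)
  have hint₂ : ∀ α : ℝ, |α| = θ → IntervalIntegrable (fun t : ℝ => Complex.exp (Complex.I * α) /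
      (t * Complex.exp (Complex.I * α) - v)) MeasureTheory.volume p.1 p.2 := fun α hα =>
    ContinuousOn.intervalIntegrable <| continuousOn_const.div (by fun_prop) fun t ht =>
      hne α hα t (hpos t ht)
  have hsplit : ∀ α : ℝ, |α| = θ → ∀ t : ℝ, 0 < t →
      Complex.exp (Complex.I * α) * w (a + t * Complex.exp (Complex.I * α)) /
        (a + t * Complex.exp (Complex.I * α) - z) =
      Complex.exp (Complex.I * α) * dslope w z (a + t * Complex.exp (Complex.I * α)) +
        w z * (Complex.exp (Complex.I * α) / (t * Complex.exp (Complex.I * α) - v)) := by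
    intro α hα t ht
    have h := hne α hα t ht
    rw [hFeq _ (sub_ne_zero.1 h), show (a : ℂ) + t * Complex.exp (Complex.I * α) - z =
      t * Complex.exp (Complex.I * α) - v by rw [hv]; ring]
    ring
  have habs : |θ| = θ := abs_of_pos hθ₀
  have habs' : |-θ| = θ := by rw [abs_neg, habs]
  have hexp : Complex.exp (-(Complex.I * θ)) = Complex.exp (Complex.I * ((-θ : ℝ) : ℂ)) := by simp
  rw [hexp, ← intervalIntegral.integral_add ((hint₁ θ habs).sub (hint₁ (-θ) habs'))
    (((hint₂ θ habs).sub (hint₂ (-θ) habs')).const_mul (w z))]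
  refine intervalIntegral.integral_congr fun t ht => ?_
  simp only [hsplit θ habs t (hpos t ht), hsplit (-θ) habs' t (hpos t ht)]
  ring
end
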